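/- arXiv:1302.6000 — 3 statements merged into one kernel-verified Lean document; each statement's English description precedes it below -/
import Mathlib

section
/- Let α > 0 and let w : ℝ × ℝ → ℝ be smooth with w(x,t) > 0 for all x, t, and suppose w solves the heat equation w_t = α·w_xx. Then the Hopf–Cole transform φ(x,t) := -2α·w_x(x,t)/w(x,t) solves the Burgers equation φ_t + φ·φ_x - α·φ_xx = 0 on ℝ × ℝ. -/
open Real Filter MeasureTheory

/-- Partial derivative in the first (space) variable. -/
noncomputable def pdx (f : ℝ × ℝ → ℝ) (x t : ℝ) : ℝ := deriv (fun y => f (y, t)) x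

/-- Partial derivative in the second (time) variable. -/
noncomputable def pdt (f : ℝ × ℝ → ℝ) (x t : ℝ) : ℝ := deriv (fun s => f (x, s)) t

/-- Second partial derivative in the first (space) variable. -/
noncomputable def pdxx (f : ℝ × ℝ → ℝ) (x t : ℝ) : ℝ := deriv (fun y => pdx f y t) x

theorem hasDerivAt_pdx {f : ℝ × ℝ → ℝ} (hf : Differentiable ℝ f) (x t : ℝ) :
    HasDerivAt (fun y => f (y, t)) (pdx f x t) x :=
  ((hf (x, t)).comp x (f := fun y : ℝ => (y, t)) (by fun_prop)).hasDerivAt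

theorem hasDerivAt_pdt {f : ℝ × ℝ → ℝ} (hf : Differentiable ℝ f) (x t : ℝ) :
    HasDerivAt (fun s => f (x, s)) (pdt f x t) t :=
  ((hf (x, t)).comp t (f := fun s : ℝ => (x, s)) (by fun_prop)).hasDerivAt

theorem pdx_eq_fderiv {f : ℝ × ℝ → ℝ} (hf : Differentiable ℝ f) (x t : ℝ) :
    pdx f x t = fderiv ℝ f (x, t) (1, 0) :=
  ((hf (x, t)).hasFDerivAt.comp_hasDerivAt x
    ((hasDerivAt_id x).prodMk (hasDerivAt_const x t))).deriv

theorem pdt_eq_fderiv {f : ℝ × ℝ → ℝ} (hf : Differentiable ℝ f) (x t : ℝ) :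
    pdt f x t = fderiv ℝ f (x, t) (0, 1) :=
  ((hf (x, t)).hasFDerivAt.comp_hasDerivAt t
    ((hasDerivAt_const t x).prodMk (hasDerivAt_id t))).deriv

theorem contDiff_pdx {f : ℝ × ℝ → ℝ} (hf : ContDiff ℝ (⊤ : ℕ∞) f) :
    ContDiff ℝ (⊤ : ℕ∞) (fun p : ℝ × ℝ => pdx f p.1 p.2) := by
  simp only [pdx_eq_fderiv (hf.differentiable (by simp))]
  exact (hf.fderiv_right (by simp)).clm_apply contDiff_const

/-- Mixed partial derivatives of a smooth function commute. -/
theorem pdt_pdx_comm {f : ℝ × ℝ → ℝ} (hf : ContDiff ℝ (⊤ : ℕ∞) f) (x t : ℝ) :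
    pdt (fun p => pdx f p.1 p.2) x t = pdx (fun p => pdt f p.1 p.2) x t := by
  have hd : Differentiable ℝ f := hf.differentiable (by simp)
  have hf' : ContDiff ℝ (⊤ : ℕ∞) (fderiv ℝ f) := hf.fderiv_right (by simp)
  have hd' : Differentiable ℝ (fderiv ℝ f) := hf'.differentiable (by simp)
  simp only [pdx_eq_fderiv hd, pdt_eq_fderiv hd]
  rw [pdt_eq_fderiv (hd'.clm_apply (differentiable_const _)),
    pdx_eq_fderiv (hd'.clm_apply (differentiable_const _)),
    fderiv_clm_apply (hd' _) (differentiableAt_const _),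
    fderiv_clm_apply (hd' _) (differentiableAt_const _)]
  have hsymm : IsSymmSndFDerivAt ℝ f (x, t) :=
    hf.contDiffAt.isSymmSndFDerivAt (by simpa using WithTop.coe_le_coe.2 (le_top (a := (2 : ℕ∞))))
  simpa using hsymm.eq (0, 1) (1, 0)

theorem hopf_cole_to_burgers (α : ℝ) (hα : 0 < α) (w : ℝ × ℝ → ℝ)
    (hw : ContDiff ℝ (⊤ : ℕ∞) w) (hpos : ∀ x t : ℝ, 0 < w (x, t))
    (hheat : ∀ x t : ℝ, pdt w x t = α * pdxx w x t)
    (φ : ℝ × ℝ → ℝ)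
    (hφ : φ = fun p => -2 * α * pdx w p.1 p.2 / w p) :
    ∀ x t : ℝ, pdt φ x t + φ (x, t) * pdx φ x t - α * pdxx φ x t = 0 := by
  intro x t
  have hw₁ := contDiff_pdx hw
  have hw₂ : ContDiff ℝ (⊤ : ℕ∞) (fun p : ℝ × ℝ => pdxx w p.1 p.2) := contDiff_pdx hw₁
  have hd := hw.differentiable (by simp)
  have hd₁ := hw₁.differentiable (by simp)
  have hd₂ := hw₂.differentiable (by simp)
  have hne : ∀ y s, w (y, s) ≠ 0 := fun y s => (hpos y s).ne'
  have dx₀ : ∀ y, HasDerivAt (fun z => w (z, t)) (pdx w y t) y :=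
    fun y => hasDerivAt_pdx hd y t
  have dx₁ : ∀ y, HasDerivAt (fun z => pdx w z t) (pdxx w y t) y :=
    fun y => hasDerivAt_pdx hd₁ y t
  have dx₂ := hasDerivAt_pdx hd₂ x t
  have dt₀ := hasDerivAt_pdt hd x t
  have dt₁ := hasDerivAt_pdt hd₁ x t
  rw [hheat] at dt₀
  have hmixed : pdt (fun p => pdx w p.1 p.2) x t
      = α * pdx (fun p => pdxx w p.1 p.2) x t := by
    rw [pdt_pdx_comm hw]
    simp only [hheat]
    exact (dx₂.const_mul α).deriv
  rw [hmixed] at dt₁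
  have φt := ((dt₁.const_mul (-2 * α)).div dt₀ (hne x t)).deriv
  have φx : ∀ y, pdx φ y t = (-2 * α * pdxx w y t * w (y, t)
      - -2 * α * pdx w y t * pdx w y t) / w (y, t) ^ 2 := by
    intro y
    rw [hφ]
    exact (((dx₁ y).const_mul (-2 * α)).div (dx₀ y) (hne y t)).deriv
  have φxx := (((((dx₂.const_mul (-2 * α)).mul (dx₀ x)).sub
    (((dx₁ x).const_mul (-2 * α)).mul (dx₁ x))).div ((dx₀ x).pow 2)
      (pow_ne_zero 2 (hne x t)))).deriv
  have φt' := Eq.trans (a := pdt φ x t) (by rw [hφ]; rfl) φt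
  have φxx' := Eq.trans (a := pdxx φ x t) (by unfold pdxx; simp only [φx]; rfl) φxx
  rw [φt', φxx', φx, hφ]
  have h := hne x t
  simp only [Pi.mul_apply, Pi.sub_apply, Pi.pow_apply]
  field_simp
  ring
end

section
/- Let α > 0, c, b ∈ ℝ and a ≥ 0 with a + exp(-c·x/(2α) + c²·t/(4α) - b) > 0 for all x, t (automatic since a ≥ 0). Then φ(x,t) := -2α·log[a + exp(-c·x/(2α) + c²·t/(4α) - b)] solves the nonlinear diffusion equation φ_t + (1/2)·(φ_x)² - α·φ_xx = 0 on ℝ × ℝ. -/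
open Real Filter MeasureTheory

theorem hasDerivAt_exp_phase_space (α c b x t : ℝ) :
    HasDerivAt (fun y => Real.exp (-c * y / (2 * α) + c ^ 2 * t / (4 * α) - b))
      (Real.exp (-c * x / (2 * α) + c ^ 2 * t / (4 * α) - b) * (-c / (2 * α))) x := by
  have h := (((hasDerivAt_id x).const_mul (-c)).div_const (2 * α)).add_const
    (c ^ 2 * t / (4 * α)) |>.sub_const b |>.exp
  simpa using h

theorem hasDerivAt_exp_phase_time (α c b x t : ℝ) :
    HasDerivAt (fun s => Real.exp (-c * x / (2 * α) + c ^ 2 * s / (4 * α) - b))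
      (Real.exp (-c * x / (2 * α) + c ^ 2 * t / (4 * α) - b) * (c ^ 2 / (4 * α))) t := by
  have h := (((hasDerivAt_id t).const_mul (c ^ 2)).div_const (4 * α)).const_add
    (-c * x / (2 * α)) |>.sub_const b |>.exp
  simpa using h

theorem explicit_nde_solution (α : ℝ) (hα : 0 < α) (c b a : ℝ) (ha : 0 ≤ a)
    (hpos : ∀ x t : ℝ, 0 < a + Real.exp (-c * x / (2 * α) + c ^ 2 * t / (4 * α) - b))
    (φ : ℝ × ℝ → ℝ)
    (hφ : φ = fun p =>
      -2 * α * Real.log (a + Real.exp (-c * p.1 / (2 * α) + c ^ 2 * p.2 / (4 * α) - b))) :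
    ∀ x t : ℝ, pdt φ x t + (1 / 2) * (pdx φ x t) ^ 2 - α * pdxx φ x t = 0 := by
  subst hφ
  intro x t
  have hα' : α ≠ 0 := hα.ne'
  have hx : ∀ y : ℝ, pdx (fun p : ℝ × ℝ => -2 * α *
      Real.log (a + Real.exp (-c * p.1 / (2 * α) + c ^ 2 * p.2 / (4 * α) - b))) y t =
      c * (Real.exp (-c * y / (2 * α) + c ^ 2 * t / (4 * α) - b) /
        (a + Real.exp (-c * y / (2 * α) + c ^ 2 * t / (4 * α) - b))) := by
    intro y
    have hne := (hpos y t).ne'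
    have h := (((hasDerivAt_exp_phase_space α c b y t).const_add a).log hne).const_mul (-2 * α)
    refine h.deriv.trans ?_
    field_simp
  have ht : pdt (fun p : ℝ × ℝ => -2 * α *
      Real.log (a + Real.exp (-c * p.1 / (2 * α) + c ^ 2 * p.2 / (4 * α) - b))) x t =
      -2 * α * (Real.exp (-c * x / (2 * α) + c ^ 2 * t / (4 * α) - b) * (c ^ 2 / (4 * α)) /
        (a + Real.exp (-c * x / (2 * α) + c ^ 2 * t / (4 * α) - b))) :=
    ((((hasDerivAt_exp_phase_time α c b x t).const_add a).log (hpos x t).ne').const_mul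
      (-2 * α)).deriv
  have hne := (hpos x t).ne'
  have hE := hasDerivAt_exp_phase_space α c b x t
  have hxx := ((hE.fun_div (hE.const_add a) hne).const_mul c).deriv
  rw [pdxx, funext hx, hxx, hx, ht]
  generalize Real.exp (-c * x / (2 * α) + c ^ 2 * t / (4 * α) - b) = E at hne ⊢
  field_simp
  ring
end

section
/- Let α > 0, u > 0, and C₁, C₂ ∈ ℝ. On the region where X(x,t) := u·(x - u·t)/α + 2u·C₁ > 0 (so that exp(X) - 1 > 0), the travelling wave φ(x,t) := 2u·(x - u·t) - 2α·log(exp(X(x,t)) - 1) + C₂ solves the nonlinear diffusion equation φ_t + (1/2)·(φ_x)² - α·φ_xx = 0. -/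
open Real Filter MeasureTheory

/-- Chain rule for the wave profile along a phase `ξ`. -/
theorem hasDerivAt_wave_profile {α : ℝ} (hα : α ≠ 0) (u b C₂ : ℝ) {ξ : ℝ → ℝ} {ξ' s : ℝ}
    (hξ : HasDerivAt ξ ξ' s) (hpos : 0 < u * ξ s / α + b) :
    HasDerivAt
      (fun r => 2 * u * ξ r - 2 * α * Real.log (Real.exp (u * ξ r / α + b) - 1) + C₂)
      (-2 * u * ξ' / (Real.exp (u * ξ s / α + b) - 1)) s := by
  have hE : Real.exp (u * ξ s / α + b) - 1 ≠ 0 :=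
    (sub_pos.2 (Real.one_lt_exp_iff.2 hpos)).ne'
  have hX : HasDerivAt (fun r => u * ξ r / α + b) (u * ξ' / α) s :=
    ((hξ.const_mul u).div_const α).add_const b
  have hlog := (hX.exp.sub_const 1).log hE
  refine (((hξ.const_mul (2 * u)).sub (hlog.const_mul (2 * α))).add_const C₂).congr_deriv ?_
  generalize Real.exp (u * ξ s / α + b) = E at hE ⊢
  field_simp
  ring

theorem travelling_wave_nde (α : ℝ) (hα : 0 < α) (u : ℝ) (hu : 0 < u) (C₁ C₂ : ℝ)
    (X : ℝ × ℝ → ℝ) (hX : X = fun p => u * (p.1 - u * p.2) / α + 2 * u * C₁)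
    (φ : ℝ × ℝ → ℝ)
    (hφ : φ = fun p =>
      2 * u * (p.1 - u * p.2) - 2 * α * Real.log (Real.exp (X p) - 1) + C₂) :
    ∀ x t : ℝ, 0 < X (x, t) →
      pdt φ x t + (1 / 2) * (pdx φ x t) ^ 2 - α * pdxx φ x t = 0 := by
  intro x t hpos
  subst hX
  subst hφ
  have hα' := hα.ne'
  simp only at hpos
  have hξx : ∀ y, HasDerivAt (fun r => r - u * t) 1 y := fun y =>
    (hasDerivAt_id y).sub_const (u * t)
  have hξt : HasDerivAt (fun s => x - u * s) (-u) t := by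
    simpa using ((hasDerivAt_id t).const_mul u).const_sub x
  have hX : HasDerivAt (fun r => u * (r - u * t) / α + 2 * u * C₁) (u / α) x := by
    simpa using (((hξx x).const_mul u).div_const α).add_const (2 * u * C₁)
  have hE : Real.exp (u * (x - u * t) / α + 2 * u * C₁) - 1 ≠ 0 :=
    (sub_pos.2 (Real.one_lt_exp_iff.2 hpos)).ne'
  have hpdx : ∀ y, 0 < u * (y - u * t) / α + 2 * u * C₁ →
      pdx (fun p : ℝ × ℝ => 2 * u * (p.1 - u * p.2) - 2 * α *
        Real.log (Real.exp (u * (p.1 - u * p.2) / α + 2 * u * C₁) - 1) + C₂) y t =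
      -2 * u * 1 / (Real.exp (u * (y - u * t) / α + 2 * u * C₁) - 1) := fun y hy =>
    (hasDerivAt_wave_profile hα' u (2 * u * C₁) C₂ (hξx y) hy).deriv
  have hpdt := (hasDerivAt_wave_profile hα' u (2 * u * C₁) C₂ hξt hpos).deriv
  have hpdxx := ((hasDerivAt_const x (-2 * u * 1)).div (hX.exp.sub_const 1) hE).congr_of_eventuallyEq
    ((hX.continuousAt.eventually (lt_mem_nhds hpos)).mono hpdx)
  rw [hpdx x hpos, pdt, hpdt, pdxx, hpdxx.deriv]
  generalize Real.exp (u * (x - u * t) / α + 2 * u * C₁) = E at hE ⊢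
  field_simp
  ring
end
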